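/- Suppose l₁,…,lₙ are not all equal. Then there exists a constant M > 0 such that for every integer k > 0, the set A_k = {⟨i⟩ : i ∈ ℕⁿ, |i| = k, #R_i < 𝓜} has cardinality at most M·k^{n−2}. -/

import Mathlib

/-- `⟨i⟩`: the multiset of coordinates of an integer tuple `i`. -/
def cls {n : ℕ} (i : Fin n → ℤ) : Multiset ℤ :=
  Multiset.map i Finset.univ.val

-- `𝓜`: the number of distinct rearrangements `l_π` of the tuple `l`.
open Classical in
noncomputable def Mcount {n : ℕ} (l : Fin n → ℤ) : ℕ :=
  (Finset.univ.image fun π : Equiv.Perm (Fin n) => l ∘ π).card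

/-- `R_i = {⟨j⟩ : j ∈ ℕⁿ, ∃ π ∈ Σₙ, ⟨j + l_π⟩ = ⟨i⟩}`. -/
def Rset {n : ℕ} (l : Fin n → ℤ) (i : Fin n → ℕ) : Set (Multiset ℤ) :=
  {m | ∃ j : Fin n → ℕ, m = cls (fun a => (j a : ℤ)) ∧
        ∃ π : Equiv.Perm (Fin n),
          cls (fun a => (j a : ℤ) + l (π a)) = cls (fun a => (i a : ℤ))}

theorem aux_T {n : ℕ} (k : ℕ) (a b : Fin n) (hab : a ≠ b) (s d : ℤ) (hs : 0 ≤ s) :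
    ((Fintype.piFinset (fun _ : Fin n => Finset.range (k+1))).filter
      (fun i => (∑ x, i x) = k ∧ (i a : ℤ) - s * i b = d)).card ≤ (k+1)^(n-2) := by
  classical
  have hc : Fintype.card {x : Fin n // x ∈ ((Finset.univ.erase a).erase b)} = n - 2 := by
    rw [Fintype.card_coe, Finset.card_erase_of_mem (by simp [hab.symm]),
      Finset.card_erase_of_mem (by simp)]
    simp; omega
  have h := Finset.card_le_card_of_injOn
    (s := ((Fintype.piFinset (fun _ : Fin n => Finset.range (k+1))).filter
      (fun i => (∑ x, i x) = k ∧ (i a : ℤ) - s * i b = d)))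
    (t := Fintype.piFinset
      (fun _ : {x : Fin n // x ∈ ((Finset.univ.erase a).erase b)} => Finset.range (k+1)))
    (fun i x => i x.1) ?_ ?_
  · rw [Fintype.card_coe] at hc
    simpa [Fintype.card_piFinset, hc] using h
  · intro i hi
    simp only [Finset.coe_filter, Set.mem_ofPred_eq, Fintype.mem_piFinset] at hi
    simp only [Finset.mem_coe, Fintype.mem_piFinset]
    exact fun x => hi.1 x.1
  · intro i hi j hj hij
    simp only [Finset.coe_filter, Set.mem_ofPred_eq] at hi hj
    have key : ∀ x, x ≠ a → x ≠ b → i x = j x := by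
      intro x hxa hxb
      exact congrFun hij ⟨x, by simp [hxa, hxb]⟩
    have dec : ∀ f : Fin n → ℕ, ∑ x, f x = f a + (f b + ∑ x ∈ (Finset.univ.erase a).erase b, f x) := by
      intro f
      rw [Finset.add_sum_erase _ _ (by simp [hab.symm]), Finset.add_sum_erase _ _ (by simp)]
    have hsum : ∑ x ∈ (Finset.univ.erase a).erase b, i x
        = ∑ x ∈ (Finset.univ.erase a).erase b, j x := by
      apply Finset.sum_congr rfl
      intro x hx
      simp at hx
      exact key x hx.2 hx.1
    have h1 := hi.2.1
    have h2 := hj.2.1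
    rw [dec] at h1 h2
    have e : i a + i b = j a + j b := by omega
    have e' : (i a : ℤ) + i b = j a + j b := by exact_mod_cast e
    have hb : (1 + s) * ((i b : ℤ) - j b) = 0 := by
      linear_combination e' - hi.2.2 + hj.2.2
    have hb' : i b = j b := by
      rcases mul_eq_zero.1 hb with h | h <;> omega
    funext x
    by_cases hxa : x = a
    · subst hxa; omega
    · by_cases hxb : x = b
      · subst hxb; exact hb'
      · exact key x hxa hxb

theorem cls_perm {n : ℕ} {f g : Fin n → ℤ} (h : cls f = cls g) :
    ∃ σ : Equiv.Perm (Fin n), f = g ∘ σ := by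
  classical
  unfold cls at h
  have hc : ∀ y, Fintype.card {x // f x = y} = Fintype.card {x // g x = y} := by
    intro y
    have := congrArg (Multiset.count y) h
    rw [Multiset.count_map, Multiset.count_map] at this
    rw [Fintype.card_subtype, Fintype.card_subtype]
    simp only [Finset.card, Finset.filter_val]
    simpa only [eq_comm] using this
  let e : ∀ y, {x // f x = y} ≃ {x // g x = y} := fun y => Fintype.equivOfCardEq (hc y)
  refine ⟨(Equiv.sigmaFiberEquiv f).symm.trans
    ((Equiv.sigmaCongrRight e).trans (Equiv.sigmaFiberEquiv g)), ?_⟩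
  funext x
  exact ((e (f x)) ⟨x, rfl⟩).2.symm

theorem cls_comp {n : ℕ} (f : Fin n → ℤ) (σ : Equiv.Perm (Fin n)) : cls (f ∘ σ) = cls f := by
  unfold cls
  rw [← Multiset.map_map]
  congr 1
  have := congrArg Finset.val (Finset.map_univ_equiv σ)
  simpa using this

theorem Rset_finite {n : ℕ} (l : Fin n → ℤ) (i : Fin n → ℕ) : (Rset l i).Finite := by
  apply (Set.finite_range (fun p : Equiv.Perm (Fin n) × Equiv.Perm (Fin n) =>
    cls (fun a => (i (p.1 a) : ℤ) - l (p.2 a)))).subset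
  rintro m ⟨j, rfl, π, h⟩
  obtain ⟨σ, hσ⟩ := cls_perm h
  refine ⟨(σ, π), ?_⟩
  simp only
  congr 1
  funext a
  have := congrFun hσ a
  simp at this
  omega

theorem good {n : ℕ} (l : Fin n → ℤ) (L : ℕ) (hL : ∀ a, |l a| ≤ L) (i : Fin n → ℕ)
    (h1 : ∀ a, L ≤ i a) (h2 : ∀ a b, a ≠ b → (2 * L : ℤ) < |(i a : ℤ) - i b|) :
    Mcount l ≤ Set.ncard (Rset l i) := by
  classical
  unfold Mcount
  rw [← Set.ncard_coe_finset]
  refine Set.ncard_le_ncard_of_injOn (fun l' => cls (fun a => (i a : ℤ) - l' a)) ?_ ?_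
    (Rset_finite l i)
  · intro l' hl'
    simp at hl'
    obtain ⟨π, rfl⟩ := hl'
    have hn : ∀ a, 0 ≤ (i a : ℤ) - l (π a) := by
      intro a
      have := abs_le.1 (hL (π a))
      have := h1 a
      omega
    refine ⟨fun a => ((i a : ℤ) - l (π a)).toNat, ?_, π, ?_⟩
    · simp only [Function.comp]
      congr 1; funext a; rw [Int.toNat_of_nonneg (hn a)]
    · congr 1; funext a; rw [Int.toNat_of_nonneg (hn a)]; ring
  · intro l' hl' l'' hl'' h
    simp at hl' hl''
    obtain ⟨π, rfl⟩ := hl'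
    obtain ⟨ρ, rfl⟩ := hl''
    obtain ⟨σ, hσ⟩ := cls_perm h
    have hσ1 : ∀ a, σ a = a := by
      intro a
      by_contra hne
      have := h2 _ _ hne
      have e := congrFun hσ a
      simp at e
      have b1 := abs_le.1 (hL (π a))
      have b2 := abs_le.1 (hL (ρ (σ a)))
      rcases lt_abs.1 this with h | h <;> omega
    funext a
    have e := congrFun hσ a
    simp [hσ1] at e
    simpa using e

theorem statement0 {n : ℕ} (hn : 2 ≤ n) (l : Fin n → ℤ)
    (hl : ¬ ∀ a b : Fin n, l a = l b) :
    ∃ M : ℝ, 0 < M ∧ ∀ k : ℕ, 0 < k →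
      (Set.ncard {m : Multiset ℤ | ∃ i : Fin n → ℕ,
          m = cls (fun a => (i a : ℤ)) ∧ (∑ a, i a) = k ∧
          Set.ncard (Rset l i) < Mcount l} : ℝ) ≤ M * (k : ℝ) ^ (n - 2) := by
  classical
  obtain ⟨L, hL⟩ : ∃ L : ℕ, ∀ a, |l a| ≤ L := by
    refine ⟨∑ a, (l a).natAbs, fun a => ?_⟩
    rw [Int.abs_eq_natAbs]
    exact_mod_cast Finset.single_le_sum (f := fun a => (l a).natAbs) (by simp) (Finset.mem_univ a)
  let I : Finset ((Fin n × Fin n) × (ℤ × ℤ)) :=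
    (Finset.univ : Finset (Fin n)).offDiag ×ˢ (({0, 1} : Finset ℤ) ×ˢ Finset.Icc (-(2*L:ℤ)) (2*L))
  let T : ℕ → ((Fin n × Fin n) × (ℤ × ℤ)) → Finset (Fin n → ℕ) := fun k p =>
    (Fintype.piFinset (fun _ : Fin n => Finset.range (k+1))).filter
      (fun i => (∑ x, i x) = k ∧ (i p.1.1 : ℤ) - p.2.1 * i p.1.2 = p.2.2)
  refine ⟨(I.card + 1) * 2 ^ (n-2), by positivity, fun k hk => ?_⟩
  have hcard : (I.biUnion (T k)).card ≤ I.card * (k+1)^(n-2) := by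
    apply Finset.card_biUnion_le_card_mul
    rintro ⟨⟨a, b⟩, s, d⟩ hp
    simp [I] at hp
    exact aux_T k a b hp.1 s d (by omega)
  have hsub : {m : Multiset ℤ | ∃ i : Fin n → ℕ,
          m = cls (fun a => (i a : ℤ)) ∧ (∑ a, i a) = k ∧
          Set.ncard (Rset l i) < Mcount l} ⊆
      (((I.biUnion (T k)).image (fun i => cls (fun a => (i a : ℤ))) : Finset _) : Set (Multiset ℤ)) := by
    rintro m ⟨i, rfl, hk, hlt⟩
    rw [Finset.mem_coe]
    apply Finset.mem_image_of_mem (fun i : Fin n → ℕ => cls (fun a => (i a : ℤ)))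
    have hr : i ∈ Fintype.piFinset (fun _ : Fin n => Finset.range (k+1)) := by
      simp only [Fintype.mem_piFinset, Finset.mem_range]
      intro a
      have := Finset.single_le_sum (f := i) (by simp) (Finset.mem_univ a)
      omega
    by_contra hnot
    simp only [Finset.mem_biUnion, not_exists, not_and, T, Finset.mem_filter] at hnot
    apply absurd hlt
    rw [not_lt]
    apply good l L hL i
    · intro a
      by_contra hlt
      haveI : Nontrivial (Fin n) := Fin.nontrivial_iff_two_le.2 hn
      obtain ⟨b, hb⟩ := exists_ne a
      refine hnot ((a, b), (0, (i a : ℤ))) ?_ hr hk (by simp)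
      simp [I, hb.symm]
      omega
    · intro a b hab
      by_contra hlt
      rw [not_lt, abs_le] at hlt
      refine hnot ((a, b), (1, (i a : ℤ) - i b)) ?_ hr hk (by simp)
      simp [I, hab]
      omega
  have hle : Set.ncard {m : Multiset ℤ | ∃ i : Fin n → ℕ,
          m = cls (fun a => (i a : ℤ)) ∧ (∑ a, i a) = k ∧
          Set.ncard (Rset l i) < Mcount l} ≤ I.card * (k+1)^(n-2) := by
    refine (Set.ncard_le_ncard hsub (Finset.finite_toSet _)).trans ?_
    rw [Set.ncard_coe_finset]
    exact Finset.card_image_le.trans hcard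
  have hk1 : (1:ℝ) ≤ k := by exact_mod_cast hk
  calc _ ≤ ((I.card * (k+1)^(n-2) : ℕ) : ℝ) := by exact_mod_cast hle
    _ = (I.card : ℝ) * ((k:ℝ)+1)^(n-2) := by push_cast; ring
    _ ≤ ((I.card : ℝ) + 1) * (2 * (k:ℝ))^(n-2) := by
        gcongr
        · linarith
        · linarith
    _ = _ := by rw [mul_pow]; ring
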